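/- For integers n, r ≥ 1 and 1 ≤ k ≤ n, let W_r^{(n)}(k) = n^{-r}·Σ_{j|k} φ(j)·⌊n/j⌋^r, and let d_r^{(n)} = (1/n)·Σ_{k=1}^n (W_r^{(n)}(k))² − ((1/n)·Σ_{k=1}^n W_r^{(n)}(k))² be the variance of W_r^{(n)} under the uniform distribution on {1,…,n}. Then: (a) for each fixed integer r ≥ 2, lim_{n→∞} d_r^{(n)} = Σ_{i,j≥1} (φ(i)/i^{r+1})·(φ(j)/j^{r+1})·(gcd(i,j) − 1); and (b) for r = 1, d_1^{(n)} ∼ Δ_Toth·(ln n)³ as n → ∞, where Δ_Toth = (1/6)·Π_p (1 − 5/p² + 5/p³ − 1/p⁵). -/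

import Mathlib

open Filter

/-- The marginal expectation `W_r^{(n)}(k) = n^{-r} Σ_{j∣k} φ(j) ⌊n/j⌋^r`. -/
noncomputable def margW (r n k : ℕ) : ℝ :=
  ((n : ℝ) ^ r)⁻¹ * ∑ j ∈ k.divisors, (Nat.totient j : ℝ) * ((n / j : ℕ) : ℝ) ^ r

/-- The variance `d_r^{(n)}` of `W_r^{(n)}` under the uniform distribution on `{1,…,n}`. -/
noncomputable def margWVar (r n : ℕ) : ℝ :=
  (1 / (n : ℝ)) * ∑ k ∈ Finset.Icc 1 n, margW r n k ^ 2 -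
    ((1 / (n : ℝ)) * ∑ k ∈ Finset.Icc 1 n, margW r n k) ^ 2

/-- Toth's constant `Δ_Toth = (1/6) Π_p (1 − 5/p² + 5/p³ − 1/p⁵)`. -/
noncomputable def DeltaToth : ℝ :=
  (1 / 6) * ∏' p : Nat.Primes,
    (1 - 5 / ((p : ℕ) : ℝ) ^ 2 + 5 / ((p : ℕ) : ℝ) ^ 3 - 1 / ((p : ℕ) : ℝ) ^ 5)

lemma pow_succ_sub_pow_succ_bounds {a b : ℝ} (hb : 0 ≤ b) (hab : b ≤ a) (j : ℕ) :
    ((j : ℝ) + 1) * b ^ j * (a - b) ≤ a ^ (j + 1) - b ^ (j + 1) ∧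
      a ^ (j + 1) - b ^ (j + 1) ≤ ((j : ℝ) + 1) * a ^ j * (a - b) := by
  have ha : 0 ≤ a := hb.trans hab
  induction j with
  | zero => simp
  | succ j ih =>
    have e : a ^ (j + 1 + 1) - b ^ (j + 1 + 1)
        = a * (a ^ (j + 1) - b ^ (j + 1)) + b ^ (j + 1) * (a - b) := by ring
    have hd : 0 ≤ a - b := sub_nonneg.2 hab
    rw [e]
    push_cast
    constructor
    · have h1 : b * (((j : ℝ) + 1) * b ^ j * (a - b)) ≤ a * (a ^ (j + 1) - b ^ (j + 1)) :=
        mul_le_mul hab ih.1 (by positivity) ha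
      calc ((j : ℝ) + 1 + 1) * b ^ (j + 1) * (a - b)
          = b * (((j : ℝ) + 1) * b ^ j * (a - b)) + b ^ (j + 1) * (a - b) := by ring
        _ ≤ _ := by gcongr
    · have h1 := mul_le_mul_of_nonneg_left ih.2 ha
      have h2 : b ^ (j + 1) * (a - b) ≤ a ^ (j + 1) * (a - b) := by gcongr
      calc _ ≤ a * (((j : ℝ) + 1) * a ^ j * (a - b)) + a ^ (j + 1) * (a - b) := by gcongr
        _ = _ := by ring

lemma log_div_sub_log_div_succ_bounds {x : ℝ} (hx : 0 < x) {m : ℕ} (hm : 1 ≤ m) :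
    ((m : ℝ) + 1)⁻¹ ≤ Real.log (x / m) - Real.log (x / (m + 1)) ∧
      Real.log (x / m) - Real.log (x / (m + 1)) ≤ (m : ℝ)⁻¹ := by
  have hm0 : (0 : ℝ) < m := by exact_mod_cast hm
  have e : Real.log (x / m) - Real.log (x / (m + 1)) = Real.log ((m + 1) / m) := by
    rw [Real.log_div hx.ne' hm0.ne', Real.log_div hx.ne' (by positivity),
      Real.log_div (by positivity) hm0.ne']
    ring
  rw [e]
  constructor
  · have := Real.one_sub_inv_le_log_of_pos (x := ((m : ℝ) + 1) / m) (by positivity)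
    refine le_trans (le_of_eq ?_) this
    field_simp
    ring
  · have := Real.log_le_sub_one_of_pos (x := ((m : ℝ) + 1) / m) (by positivity)
    refine this.trans (le_of_eq ?_)
    field_simp
    ring

/-- Partial sums of `log (x / m) ^ j / m` compared with the primitive `log x ^ (j + 1)`. -/
lemma sum_log_pow_div_bounds (j : ℕ) {x : ℝ} {N : ℕ} (hN : 1 ≤ N) (hNx : (N : ℝ) ≤ x) :
    ((j : ℝ) + 1) * ∑ m ∈ Finset.Ioc 0 N, Real.log (x / m) ^ j / m ≤
        ((j : ℝ) + 1) * Real.log x ^ j + Real.log x ^ (j + 1) - Real.log (x / N) ^ (j + 1) ∧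
      Real.log x ^ (j + 1) - Real.log (x / N) ^ (j + 1) +
          ((j : ℝ) + 1) * (Real.log (x / N) ^ j / N) ≤
        ((j : ℝ) + 1) * ∑ m ∈ Finset.Ioc 0 N, Real.log (x / m) ^ j / m := by
  induction N, hN using Nat.le_induction with
  | base => simp
  | succ N hN ih =>
    push_cast at hNx
    obtain ⟨ih1, ih2⟩ := ih (by linarith)
    have hN0 : (0 : ℝ) < N := by exact_mod_cast hN
    have hx : 0 < x := by linarith
    obtain ⟨l1, l2⟩ := log_div_sub_log_div_succ_bounds hx hN
    rw [Finset.sum_Ioc_succ_top (Nat.zero_le N)]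
    push_cast
    have hb : 0 ≤ Real.log (x / (N + 1)) :=
      Real.log_nonneg ((one_le_div (by positivity)).2 hNx)
    have hab : Real.log (x / (N + 1)) ≤ Real.log (x / N) := by
      have : 0 ≤ ((N : ℝ) + 1)⁻¹ := by positivity
      linarith
    obtain ⟨p1, p2⟩ := pow_succ_sub_pow_succ_bounds hb hab j
    set a := Real.log (x / N)
    set b := Real.log (x / (N + 1))
    have q1 : ((j : ℝ) + 1) * (b ^ j / (N + 1)) ≤ ((j : ℝ) + 1) * b ^ j * (a - b) := by
      rw [div_eq_mul_inv, ← mul_assoc]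
      gcongr
    have ha : 0 ≤ a := hb.trans hab
    have q2 : ((j : ℝ) + 1) * a ^ j * (a - b) ≤ ((j : ℝ) + 1) * (a ^ j / N) := by
      rw [div_eq_mul_inv, ← mul_assoc]
      gcongr
    rw [mul_add]
    constructor <;> linarith

lemma abs_sum_log_pow_div_sub_le (j : ℕ) {x : ℝ} (hx : 1 ≤ x) :
    |∑ m ∈ Finset.Ioc 0 ⌊x⌋₊, Real.log (x / m) ^ j / m - Real.log x ^ (j + 1) / (j + 1)| ≤
      Real.log x ^ j := by
  have hN : 1 ≤ ⌊x⌋₊ := Nat.le_floor (by simpa using hx)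
  have hNx : (⌊x⌋₊ : ℝ) ≤ x := Nat.floor_le (by linarith)
  obtain ⟨h1, h2⟩ := sum_log_pow_div_bounds j hN hNx
  have hN0 : (1 : ℝ) ≤ ⌊x⌋₊ := by exact_mod_cast hN
  have hA0 : 0 ≤ Real.log (x / ⌊x⌋₊) :=
    Real.log_nonneg ((one_le_div (by positivity)).2 hNx)
  have hA1 : Real.log (x / ⌊x⌋₊) ≤ 1 := by
    have h3 : x / ⌊x⌋₊ ≤ 2 := by
      rw [div_le_iff₀ (by positivity)]
      have := Nat.lt_floor_add_one x
      linarith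
    have := Real.log_le_sub_one_of_pos (x := x / ⌊x⌋₊) (by positivity)
    linarith
  have hAL : Real.log (x / ⌊x⌋₊) ≤ Real.log x :=
    Real.log_le_log (by positivity) (div_le_self (by linarith) hN0)
  set S := ∑ m ∈ Finset.Ioc 0 ⌊x⌋₊, Real.log (x / m) ^ j / m
  set A := Real.log (x / ⌊x⌋₊)
  have hAj : A ^ (j + 1) ≤ Real.log x ^ j :=
    (pow_le_pow_of_le_one hA0 hA1 (Nat.le_succ j)).trans (pow_le_pow_left₀ hA0 hAL j)
  have hpos : 0 ≤ A ^ (j + 1) := by positivity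
  have hpos2 : 0 ≤ ((j : ℝ) + 1) * (A ^ j / ⌊x⌋₊) := by positivity
  have hL : 0 ≤ Real.log x ^ j := pow_nonneg (Real.log_nonneg hx) j
  have hj : (1 : ℝ) ≤ j + 1 := by simp
  have hjL : Real.log x ^ j ≤ ((j : ℝ) + 1) * Real.log x ^ j := le_mul_of_one_le_left hL hj
  have e : S - Real.log x ^ (j + 1) / (j + 1)
      = (((j : ℝ) + 1) * S - Real.log x ^ (j + 1)) / (j + 1) := by
    field_simp
  rw [e, abs_div, abs_of_pos (by positivity : (0 : ℝ) < j + 1), div_le_iff₀ (by positivity),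
    abs_le]
  constructor <;> linarith

lemma one_le_div_of_mem_Ioc_floor {x : ℝ} {m : ℕ} (hm : m ∈ Finset.Ioc 0 ⌊x⌋₊) :
    1 ≤ x / m ∧ x / m ≤ x := by
  rw [Finset.mem_Ioc] at hm
  have hm0 : (0 : ℝ) < m := by exact_mod_cast hm.1
  have hm1 : (1 : ℝ) ≤ m := by exact_mod_cast hm.1
  have hmx : (m : ℝ) ≤ x := (Nat.le_floor_iff' hm.1.ne').1 hm.2
  exact ⟨(one_le_div hm0).2 hmx, div_le_self (by linarith) hm1⟩

lemma sum_inv_Ioc_floor_le {x : ℝ} (hx : 1 ≤ x) :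
    ∑ m ∈ Finset.Ioc 0 ⌊x⌋₊, (m : ℝ)⁻¹ ≤ 1 + Real.log x := by
  have := (abs_le.1 (abs_sum_log_pow_div_sub_le 0 hx)).2
  simp at this
  linarith

/-- If `G y = c y log^(j+1) y + O(y (1 + log y)^j)`, then summing `G (x / m)` over `m ≤ x` gives
the same shape with one more logarithm. -/
lemma abs_sum_comp_div_sub_le {G : ℝ → ℝ} {j : ℕ} {c C : ℝ}
    (hG : ∀ y, 1 ≤ y → |G y - c * y * Real.log y ^ (j + 1)| ≤ C * y * (1 + Real.log y) ^ j)
    {x : ℝ} (hx : 1 ≤ x) :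
    |∑ m ∈ Finset.Ioc 0 ⌊x⌋₊, G (x / m) - c / (j + 2) * x * Real.log x ^ (j + 2)| ≤
      (C + |c|) * x * (1 + Real.log x) ^ (j + 1) := by
  have hL : 0 ≤ Real.log x := Real.log_nonneg hx
  have hC : 0 ≤ C := by
    have := (abs_nonneg _).trans (hG 1 le_rfl)
    simpa using this
  have h1 : |∑ m ∈ Finset.Ioc 0 ⌊x⌋₊, G (x / m) -
      ∑ m ∈ Finset.Ioc 0 ⌊x⌋₊, c * (x / m) * Real.log (x / m) ^ (j + 1)| ≤
      C * x * (1 + Real.log x) ^ (j + 1) := by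
    rw [← Finset.sum_sub_distrib]
    calc _ ≤ ∑ m ∈ Finset.Ioc 0 ⌊x⌋₊, |G (x / m) - c * (x / m) * Real.log (x / m) ^ (j + 1)| :=
          Finset.abs_sum_le_sum_abs _ _
      _ ≤ ∑ m ∈ Finset.Ioc 0 ⌊x⌋₊, C * x * (1 + Real.log x) ^ j * (m : ℝ)⁻¹ := by
          refine Finset.sum_le_sum fun m hm => ?_
          obtain ⟨y1, y2⟩ := one_le_div_of_mem_Ioc_floor hm
          refine (hG _ y1).trans ?_
          have l1 : Real.log (x / m) ≤ Real.log x := Real.log_le_log (by linarith) y2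
          have l0 := Real.log_nonneg y1
          calc C * (x / m) * (1 + Real.log (x / m)) ^ j
              ≤ C * (x / m) * (1 + Real.log x) ^ j := by gcongr
            _ = _ := by ring
      _ = C * x * (1 + Real.log x) ^ j * ∑ m ∈ Finset.Ioc 0 ⌊x⌋₊, (m : ℝ)⁻¹ := by
          rw [Finset.mul_sum]
      _ ≤ C * x * (1 + Real.log x) ^ j * (1 + Real.log x) := by
          gcongr
          exact sum_inv_Ioc_floor_le hx
      _ = _ := by ring
  have h2 : |∑ m ∈ Finset.Ioc 0 ⌊x⌋₊, c * (x / m) * Real.log (x / m) ^ (j + 1) -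
      c / (j + 2) * x * Real.log x ^ (j + 2)| ≤ |c| * x * (1 + Real.log x) ^ (j + 1) := by
    have e : ∑ m ∈ Finset.Ioc 0 ⌊x⌋₊, c * (x / m) * Real.log (x / m) ^ (j + 1) -
        c / (j + 2) * x * Real.log x ^ (j + 2) = c * x *
        (∑ m ∈ Finset.Ioc 0 ⌊x⌋₊, Real.log (x / m) ^ (j + 1) / m -
          Real.log x ^ (j + 1 + 1) / ((j + 1 : ℕ) + 1)) := by
      rw [mul_sub, Finset.mul_sum]
      congr 1
      · exact Finset.sum_congr rfl fun m _ => by ring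
      · push_cast
        ring
    rw [e, abs_mul, abs_mul, abs_of_pos (by linarith : 0 < x)]
    have := abs_sum_log_pow_div_sub_le (j + 1) hx
    gcongr
    exact this.trans (pow_le_pow_left₀ hL (by linarith) _)
  calc _ ≤ _ := abs_sub_le _ _ _
    _ ≤ _ := add_le_add h1 h2
    _ = _ := by ring

open ArithmeticFunction in
/-- Summatory function of the `k`-fold divisor function. -/
noncomputable def sumZetaPow (k : ℕ) (x : ℝ) : ℝ :=
  ∑ m ∈ Finset.Ioc 0 ⌊x⌋₊, ((zeta : ArithmeticFunction ℝ) ^ k) m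

open ArithmeticFunction in
lemma sumZetaPow_succ (k : ℕ) (x : ℝ) :
    sumZetaPow (k + 1) x = ∑ m ∈ Finset.Ioc 0 ⌊x⌋₊, sumZetaPow k (x / m) := by
  unfold sumZetaPow
  rw [pow_succ', sum_Ioc_mul_eq_sum_sum]
  refine Finset.sum_congr rfl fun m hm => ?_
  rw [Finset.mem_Ioc] at hm
  rw [Nat.floor_div_natCast, natCoe_apply, zeta_apply_ne hm.1.ne']
  simp

lemma sumZetaPow_one (x : ℝ) : sumZetaPow 1 x = ⌊x⌋₊ := by
  have := ArithmeticFunction.sum_Ioc_zeta ⌊x⌋₊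
  simp only [sumZetaPow, pow_one, ArithmeticFunction.natCoe_apply]
  exact_mod_cast this

lemma abs_sumZetaPow_two_sub_le {x : ℝ} (hx : 1 ≤ x) :
    |sumZetaPow 2 x - x * Real.log x| ≤ 2 * x := by
  have hx0 : 0 < x := by linarith
  rw [sumZetaPow_succ]
  have h1 : |∑ m ∈ Finset.Ioc 0 ⌊x⌋₊, sumZetaPow 1 (x / m) -
      ∑ m ∈ Finset.Ioc 0 ⌊x⌋₊, x / m| ≤ x := by
    rw [← Finset.sum_sub_distrib]
    calc _ ≤ ∑ m ∈ Finset.Ioc 0 ⌊x⌋₊, |sumZetaPow 1 (x / m) - x / m| :=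
          Finset.abs_sum_le_sum_abs _ _
      _ ≤ ∑ m ∈ Finset.Ioc 0 ⌊x⌋₊, (1 : ℝ) := by
          refine Finset.sum_le_sum fun m _ => ?_
          rw [sumZetaPow_one, abs_le]
          have := Nat.floor_le (by positivity : 0 ≤ x / m)
          have := Nat.lt_floor_add_one (x / m)
          constructor <;> linarith
      _ ≤ x := by
          simpa using Nat.floor_le hx0.le
  have h2 : |∑ m ∈ Finset.Ioc 0 ⌊x⌋₊, x / m - x * Real.log x| ≤ x := by
    have := abs_sum_log_pow_div_sub_le 0 hx
    simp only [pow_zero, zero_add, pow_one, Nat.cast_zero, div_one] at this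
    have e : ∑ m ∈ Finset.Ioc 0 ⌊x⌋₊, x / m - x * Real.log x =
        x * (∑ m ∈ Finset.Ioc 0 ⌊x⌋₊, 1 / (m : ℝ) - Real.log x) := by
      rw [mul_sub, Finset.mul_sum]
      simp [div_eq_mul_inv]
    rw [e, abs_mul, abs_of_pos hx0]
    exact mul_le_of_le_one_right hx0.le this
  calc _ ≤ _ := abs_sub_le _ _ _
    _ ≤ _ := add_le_add h1 h2
    _ = _ := by ring

lemma abs_sumZetaPow_four_sub_le {x : ℝ} (hx : 1 ≤ x) :
    |sumZetaPow 4 x - 1 / 6 * x * Real.log x ^ 3| ≤ 7 / 2 * x * (1 + Real.log x) ^ 2 := by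
  have h3 : ∀ y : ℝ, 1 ≤ y → |sumZetaPow 3 y - 1 / 2 * y * Real.log y ^ (1 + 1)| ≤
      3 * y * (1 + Real.log y) ^ 1 := by
    intro y hy
    have := abs_sum_comp_div_sub_le (G := sumZetaPow 2) (j := 0) (c := 1) (C := 2)
      (fun z hz => by simpa using abs_sumZetaPow_two_sub_le hz) hy
    rw [sumZetaPow_succ]
    norm_num at this ⊢
    exact this
  have := abs_sum_comp_div_sub_le h3 hx
  rw [sumZetaPow_succ]
  norm_num at this ⊢
  exact this

lemma sumZetaPow_of_lt_one (k : ℕ) {x : ℝ} (hx : x < 1) : sumZetaPow k x = 0 := by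
  simp [sumZetaPow, Nat.floor_eq_zero.2 hx]

section PillaiQuotient

open ArithmeticFunction

lemma moebius_mul_apply_prime_pow_succ (f : ArithmeticFunction ℝ) {p : ℕ} (hp : p.Prime) (k : ℕ) :
    ((moebius : ArithmeticFunction ℝ) * f) (p ^ (k + 1)) = f (p ^ (k + 1)) - f (p ^ k) := by
  set g := (moebius : ArithmeticFunction ℝ) * f with hg
  have hf : f = (zeta : ArithmeticFunction ℝ) * g := by
    rw [hg, ← mul_assoc, coe_zeta_mul_coe_moebius, one_mul]
  have h : ∀ k : ℕ, f (p ^ k) = ∑ i ∈ Finset.range (k + 1), g (p ^ i) := fun k => by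
    rw [hf, coe_zeta_mul_apply, Nat.sum_divisors_prime_pow hp]
  rw [h, h, Finset.sum_range_succ _ (k + 1)]
  ring

lemma moebius_mul_apply_pow_zero (f : ArithmeticFunction ℝ) (p : ℕ) :
    ((moebius : ArithmeticFunction ℝ) * f) (p ^ 0) = f (p ^ 0) := by
  simp

/-- The arithmetic function `n ↦ φ(n) / n`. -/
noncomputable def totientRatio : ArithmeticFunction ℝ :=
  ⟨fun n => (Nat.totient n : ℝ) / n, by simp⟩

lemma totientRatio_apply (n : ℕ) : totientRatio n = (Nat.totient n : ℝ) / n := rfl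

lemma isMultiplicative_totientRatio : totientRatio.IsMultiplicative := by
  refine ⟨by simp [totientRatio_apply], fun {m n} h => ?_⟩
  simp only [totientRatio_apply, Nat.totient_mul h, Nat.cast_mul]
  exact mul_div_mul_comm _ _ _ _

/-- The normalized Pillai function `n ↦ ∑_{j ∣ n} φ(j) / j`. -/
noncomputable def pillaiRatio : ArithmeticFunction ℝ := zeta * totientRatio

lemma isMultiplicative_pillaiRatio : pillaiRatio.IsMultiplicative :=
  isMultiplicative_zeta.natCast.mul isMultiplicative_totientRatio

lemma pillaiRatio_apply (n : ℕ) :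
    pillaiRatio n = ∑ j ∈ n.divisors, (Nat.totient j : ℝ) / j := by
  rw [pillaiRatio, coe_zeta_mul_apply]
  rfl

lemma pillaiRatio_prime_pow {p : ℕ} (hp : p.Prime) (k : ℕ) :
    pillaiRatio (p ^ k) = 1 + k * (1 - (p : ℝ)⁻¹) := by
  have hp0 : (p : ℝ) ≠ 0 := by exact_mod_cast hp.ne_zero
  induction k with
  | zero => simp [isMultiplicative_pillaiRatio.1]
  | succ k ih =>
    have h := moebius_mul_apply_prime_pow_succ pillaiRatio hp k
    rw [pillaiRatio, ← mul_assoc, coe_moebius_mul_coe_zeta, one_mul, ← pillaiRatio,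
      totientRatio_apply, ih, Nat.totient_prime_pow_succ hp] at h
    push_cast [hp.one_le] at h ⊢
    have e : (p : ℝ) ^ k * (p - 1) / p ^ (k + 1) = 1 - (p : ℝ)⁻¹ := by
      field_simp
      ring
    rw [e] at h
    linarith

/-- The Dirichlet quotient of `pillaiRatio ^ 2` by the fourfold divisor function. -/
noncomputable def pillaiSqQuotient : ArithmeticFunction ℝ :=
  moebius * (moebius * (moebius * (moebius * pillaiRatio.pmul pillaiRatio)))

lemma isMultiplicative_pillaiSqQuotient : pillaiSqQuotient.IsMultiplicative := by
  have hm : (moebius : ArithmeticFunction ℝ).IsMultiplicative := isMultiplicative_moebius.intCast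
  exact hm.mul <| hm.mul <| hm.mul <| hm.mul <|
    isMultiplicative_pillaiRatio.pmul isMultiplicative_pillaiRatio

lemma pillaiSqQuotient_mul_zeta_pow :
    pillaiSqQuotient * (zeta : ArithmeticFunction ℝ) ^ 4 = pillaiRatio.pmul pillaiRatio := by
  have h : (moebius : ArithmeticFunction ℝ) * zeta = 1 := coe_moebius_mul_coe_zeta
  calc pillaiSqQuotient * (zeta : ArithmeticFunction ℝ) ^ 4
      = ((moebius : ArithmeticFunction ℝ) * zeta) ^ 4 * pillaiRatio.pmul pillaiRatio := by
        rw [pillaiSqQuotient]; ring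
    _ = _ := by rw [h, one_pow, one_mul]

lemma pillaiSqQuotient_prime {p : ℕ} (hp : p.Prime) :
    pillaiSqQuotient (p ^ 1) = -4 * (p : ℝ)⁻¹ + (p : ℝ)⁻¹ ^ 2 := by
  have h := fun f k => moebius_mul_apply_prime_pow_succ f hp k
  simp only [pillaiSqQuotient, h _ 0, moebius_mul_apply_pow_zero, pmul_apply,
    pillaiRatio_prime_pow hp]
  push_cast
  ring

lemma pillaiSqQuotient_prime_sq {p : ℕ} (hp : p.Prime) :
    pillaiSqQuotient (p ^ 2) = -1 + 4 * (p : ℝ)⁻¹ := by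
  have h := fun f k => moebius_mul_apply_prime_pow_succ f hp k
  simp only [pillaiSqQuotient, h _ 1, h _ 0, moebius_mul_apply_pow_zero, pmul_apply,
    pillaiRatio_prime_pow hp]
  push_cast
  ring

lemma pillaiSqQuotient_prime_cube {p : ℕ} (hp : p.Prime) :
    pillaiSqQuotient (p ^ 3) = -(p : ℝ)⁻¹ ^ 2 := by
  have h := fun f k => moebius_mul_apply_prime_pow_succ f hp k
  simp only [pillaiSqQuotient, h _ 2, h _ 1, h _ 0, moebius_mul_apply_pow_zero, pmul_apply,
    pillaiRatio_prime_pow hp]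
  push_cast
  ring

lemma pillaiSqQuotient_prime_pow_add_four {p : ℕ} (hp : p.Prime) (k : ℕ) :
    pillaiSqQuotient (p ^ (k + 4)) = 0 := by
  have h := fun f k => moebius_mul_apply_prime_pow_succ f hp k
  simp only [pillaiSqQuotient, h _ (k + 3), h _ (k + 2), h _ (k + 1), h _ k, pmul_apply,
    pillaiRatio_prime_pow hp]
  push_cast
  ring

/-- The function whose sum is the constant of the second moment. -/
noncomputable def pillaiSqWeight (n : ℕ) : ℝ := pillaiSqQuotient n / n

lemma pillaiSqWeight_one : pillaiSqWeight 1 = 1 := by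
  simp [pillaiSqWeight, isMultiplicative_pillaiSqQuotient.1]

lemma pillaiSqWeight_mul {m n : ℕ} (h : m.Coprime n) :
    pillaiSqWeight (m * n) = pillaiSqWeight m * pillaiSqWeight n := by
  simp only [pillaiSqWeight, isMultiplicative_pillaiSqQuotient.2 h, Nat.cast_mul]
  exact mul_div_mul_comm _ _ _ _

lemma hasSum_of_forall_add_four_eq_zero {f : ℕ → ℝ} (hf : ∀ k, f (k + 4) = 0) :
    HasSum f (f 0 + f 1 + f 2 + f 3) := by
  have : HasSum f (∑ k ∈ Finset.range 4, f k) := hasSum_sum_of_ne_finset_zero fun k hk => by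
    obtain ⟨l, rfl⟩ := Nat.exists_eq_add_of_le' (not_lt.1 (Finset.mem_range.not.1 hk))
    exact hf l
  simpa [Finset.sum_range_succ] using this

lemma pillaiSqWeight_prime_pow_add_four {p : ℕ} (hp : p.Prime) (k : ℕ) :
    pillaiSqWeight (p ^ (k + 4)) = 0 := by
  rw [pillaiSqWeight, pillaiSqQuotient_prime_pow_add_four hp, zero_div]

lemma tsum_pillaiSqWeight_prime_pow {p : ℕ} (hp : p.Prime) :
    ∑' k : ℕ, pillaiSqWeight (p ^ k) =
      1 - 5 / (p : ℝ) ^ 2 + 5 / (p : ℝ) ^ 3 - 1 / (p : ℝ) ^ 5 := by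
  have hp0 : (p : ℝ) ≠ 0 := by exact_mod_cast hp.ne_zero
  rw [(hasSum_of_forall_add_four_eq_zero (pillaiSqWeight_prime_pow_add_four hp)).tsum_eq, pow_zero,
    pillaiSqWeight_one]
  simp only [pillaiSqWeight, pillaiSqQuotient_prime hp, pillaiSqQuotient_prime_sq hp,
    pillaiSqQuotient_prime_cube hp]
  push_cast
  field_simp
  ring

lemma tsum_abs_pillaiSqWeight_prime_pow_le {p : ℕ} (hp : p.Prime) :
    ∑' k : ℕ, |pillaiSqWeight (p ^ k)| ≤ 1 + 11 * (1 / (p : ℝ) ^ 2) := by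
  have hp1 : (1 : ℝ) ≤ p := by exact_mod_cast hp.one_le
  have hp0 : (0 : ℝ) < p := by linarith
  rw [(hasSum_of_forall_add_four_eq_zero (f := fun k => |pillaiSqWeight (p ^ k)|) fun k => by
    rw [pillaiSqWeight_prime_pow_add_four hp, abs_zero]).tsum_eq, pow_zero, pillaiSqWeight_one]
  simp only [pillaiSqWeight, pillaiSqQuotient_prime hp, pillaiSqQuotient_prime_sq hp,
    pillaiSqQuotient_prime_cube hp]
  push_cast
  have hx0 : 0 < (p : ℝ)⁻¹ := by positivity
  have hx1 : (p : ℝ)⁻¹ ≤ 1 := inv_le_one_of_one_le₀ hp1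
  simp only [div_eq_mul_inv, one_mul, ← inv_pow, abs_mul, abs_pow, abs_of_pos hx0, abs_one, pow_one,
    abs_neg]
  set x := (p : ℝ)⁻¹
  have a1 : |-4 * x + x ^ 2| ≤ 5 * x := by rw [abs_le]; constructor <;> nlinarith
  have a2 : |-1 + 4 * x| ≤ 5 := by rw [abs_le]; constructor <;> linarith
  have b1 : |-4 * x + x ^ 2| * x ≤ 5 * x * x := by gcongr
  have b2 : |-1 + 4 * x| * x ^ 2 ≤ 5 * x ^ 2 := by gcongr
  have b3 : x ^ 2 * x ^ 3 ≤ x ^ 2 := mul_le_of_le_one_right (by positivity) (pow_le_one₀ hx0.le hx1)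
  linarith

/-- A function that is multiplicative on coprime arguments is absolutely summable as soon as its
local sums over prime powers are `1 + O(b p)` with `b` summable. -/
lemma summable_norm_of_prime_pow_le {f : ℕ → ℝ} {b : ℕ → ℝ} (h0 : f 0 = 0) (h1 : f 1 = 1)
    (hmul : ∀ {m n : ℕ}, m.Coprime n → f (m * n) = f m * f n)
    (hsum : ∀ {p : ℕ}, p.Prime → Summable fun k => |f (p ^ k)|)
    (hle : ∀ {p : ℕ}, p.Prime → ∑' k : ℕ, |f (p ^ k)| ≤ 1 + b p)
    (hb0 : ∀ n, 0 ≤ b n) (hb : Summable b) : Summable fun n => |f n| := by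
  refine summable_of_sum_range_le (c := Real.exp (∑' n, b n)) (fun n => abs_nonneg _) fun N => ?_
  obtain ⟨hs, hS⟩ := EulerProduct.summable_and_hasSum_smoothNumbers_prod_primesBelow_tsum
    (f := fun n => |f n|) (by simp [h1]) (fun h => by rw [hmul h, abs_mul])
    (fun hp => by simpa using hsum hp) N
  have hprod : ∏ p ∈ N.primesBelow, ∑' k : ℕ, |f (p ^ k)| ≤ Real.exp (∑' n, b n) := by
    calc ∏ p ∈ N.primesBelow, ∑' k : ℕ, |f (p ^ k)|
        ≤ ∏ p ∈ N.primesBelow, Real.exp (b p) := by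
          refine Finset.prod_le_prod (fun p _ => tsum_nonneg fun _ => abs_nonneg _) fun p hp => ?_
          refine (hle (Nat.prime_of_mem_primesBelow hp)).trans ?_
          linarith [Real.add_one_le_exp (b p)]
      _ = Real.exp (∑ p ∈ N.primesBelow, b p) := (Real.exp_sum _ _).symm
      _ ≤ _ := Real.exp_le_exp.2 (hb.sum_le_tsum _ fun n _ => hb0 n)
  refine le_trans ?_ hprod
  have hsub : ∀ n ∈ Finset.range N, n ≠ 0 → n ∈ N.smoothNumbers := fun n hn h0 =>
    Nat.mem_smoothNumbers_of_lt (Nat.pos_of_ne_zero h0) (Finset.mem_range.1 hn)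
  rw [← hS.tsum_eq, tsum_subtype (N.smoothNumbers) fun n => |f n|]
  have hsi : Summable ((N.smoothNumbers).indicator fun n => |f n|) :=
    (summable_subtype_iff_indicator (f := fun n => |f n|) (s := N.smoothNumbers)).1 hS.summable
  refine le_trans (Finset.sum_le_sum fun n hn => ?_)
    (hsi.sum_le_tsum (Finset.range N) fun n _ => Set.indicator_nonneg (fun _ _ => abs_nonneg _) n)
  by_cases hn0 : n = 0
  · subst hn0
    rw [h0, abs_zero]
    exact Set.indicator_nonneg (fun _ _ => abs_nonneg _) 0
  · rw [Set.indicator_of_mem (hsub n hn hn0)]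

lemma summable_one_div_nat_sq_mul (c : ℝ) : Summable fun n : ℕ => c * (1 / (n : ℝ) ^ 2) :=
  (Real.summable_one_div_nat_pow.2 one_lt_two).mul_left c

lemma summable_abs_pillaiSqWeight : Summable fun n => |pillaiSqWeight n| := by
  refine summable_norm_of_prime_pow_le (b := fun n => 11 * (1 / (n : ℝ) ^ 2))
    (by simp [pillaiSqWeight]) pillaiSqWeight_one pillaiSqWeight_mul (fun hp => ?_)
    tsum_abs_pillaiSqWeight_prime_pow_le (fun n => by positivity) (summable_one_div_nat_sq_mul 11)
  exact (hasSum_of_forall_add_four_eq_zero fun k => by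
    rw [pillaiSqWeight_prime_pow_add_four hp, abs_zero]).summable

lemma tsum_pillaiSqWeight : ∑' n, pillaiSqWeight n = ∏' p : Nat.Primes,
    (1 - 5 / ((p : ℕ) : ℝ) ^ 2 + 5 / ((p : ℕ) : ℝ) ^ 3 - 1 / ((p : ℕ) : ℝ) ^ 5) := by
  rw [← EulerProduct.eulerProduct_tprod pillaiSqWeight_one pillaiSqWeight_mul
    (by simpa using summable_abs_pillaiSqWeight) (by simp [pillaiSqWeight])]
  exact tprod_congr fun p => tsum_pillaiSqWeight_prime_pow p.2

lemma tprod_toth_ne_zero : ∏' p : Nat.Primes,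
    (1 - 5 / ((p : ℕ) : ℝ) ^ 2 + 5 / ((p : ℕ) : ℝ) ^ 3 - 1 / ((p : ℕ) : ℝ) ^ 5) ≠ 0 := by
  have h := tprod_one_add_ne_zero_of_summable (f := fun p : Nat.Primes =>
    -5 / ((p : ℕ) : ℝ) ^ 2 + 5 / ((p : ℕ) : ℝ) ^ 3 - 1 / ((p : ℕ) : ℝ) ^ 5) (fun p => ?_) ?_
  · refine (tprod_congr fun p => ?_).trans_ne h
    ring
  · have hp : (2 : ℝ) ≤ (p : ℕ) := by exact_mod_cast p.2.two_le
    have hp0 : ((p : ℕ) : ℝ) ≠ 0 := by positivity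
    have e : 1 + (-5 / ((p : ℕ) : ℝ) ^ 2 + 5 / ((p : ℕ) : ℝ) ^ 3 - 1 / ((p : ℕ) : ℝ) ^ 5) =
        (((p : ℕ) : ℝ) - 1) ^ 3 * (((p : ℕ) : ℝ) ^ 2 + 3 * (p : ℕ) + 1) / ((p : ℕ) : ℝ) ^ 5 := by
      field_simp
      ring
    rw [e]
    have : 0 < ((p : ℕ) : ℝ) - 1 := by linarith
    positivity
  · refine Summable.of_nonneg_of_le (fun _ => norm_nonneg _) (fun p => ?_)
      ((summable_one_div_nat_sq_mul 11).comp_injective Nat.Primes.coe_nat_injective)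
    have hp1 : (1 : ℝ) ≤ (p : ℕ) := by exact_mod_cast p.2.one_le
    have hx0 : 0 < ((p : ℕ) : ℝ)⁻¹ := by positivity
    have hx1 : ((p : ℕ) : ℝ)⁻¹ ≤ 1 := inv_le_one_of_one_le₀ hp1
    change |_| ≤ 11 * (1 / ((p : ℕ) : ℝ) ^ 2)
    simp only [div_eq_mul_inv, one_mul, ← inv_pow]
    set x := ((p : ℕ) : ℝ)⁻¹
    have b3 : x ^ 3 ≤ x ^ 2 := pow_le_pow_of_le_one hx0.le hx1 (by norm_num)
    have b5 : x ^ 5 ≤ x ^ 2 := pow_le_pow_of_le_one hx0.le hx1 (by norm_num)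
    have c3 : 0 ≤ x ^ 3 := by positivity
    have c5 : 0 ≤ x ^ 5 := by positivity
    rw [abs_le]
    constructor <;> linarith

end PillaiQuotient

/-- The coefficient `φ(j) (⌊n / j⌋ / n) ^ r` of `margW`. -/
noncomputable def margWCoeff (r n j : ℕ) : ℝ :=
  (Nat.totient j : ℝ) * (((n / j : ℕ) : ℝ) / n) ^ r

lemma margWCoeff_nonneg (r n j : ℕ) : 0 ≤ margWCoeff r n j := by
  unfold margWCoeff
  positivity

lemma margWCoeff_eq_zero {r n j : ℕ} (hr : r ≠ 0) (hj : j ∉ Finset.Ioc 0 n) :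
    margWCoeff r n j = 0 := by
  rcases Nat.eq_zero_or_pos j with rfl | hj0
  · simp [margWCoeff]
  · have : n < j := by
      by_contra h
      exact hj (Finset.mem_Ioc.2 ⟨hj0, not_lt.1 h⟩)
    simp [margWCoeff, Nat.div_eq_of_lt this, hr]

lemma margW_eq_sum_coeff {r n k : ℕ} (hk : k ∈ Finset.Ioc 0 n) :
    margW r n k = ∑ j ∈ Finset.Ioc 0 n, if j ∣ k then margWCoeff r n j else 0 := by
  rw [Finset.mem_Ioc] at hk
  rw [margW, Finset.mul_sum, ← Finset.sum_filter]
  have e : (Finset.Ioc 0 n).filter (· ∣ k) = k.divisors := by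
    ext j
    simp only [Finset.mem_filter, Finset.mem_Ioc, Nat.mem_divisors]
    constructor
    · rintro ⟨_, h⟩
      exact ⟨h, hk.1.ne'⟩
    · rintro ⟨h, _⟩
      exact ⟨⟨Nat.pos_of_dvd_of_pos h hk.1, (Nat.le_of_dvd hk.1 h).trans hk.2⟩, h⟩
  rw [e]
  refine Finset.sum_congr rfl fun j _ => ?_
  rw [margWCoeff, div_pow]
  ring

lemma sum_margW (r n : ℕ) : ∑ k ∈ Finset.Ioc 0 n, margW r n k =
    ∑ j ∈ Finset.Ioc 0 n, margWCoeff r n j * ((n / j : ℕ) : ℝ) := by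
  rw [Finset.sum_congr rfl fun k hk => margW_eq_sum_coeff hk, Finset.sum_comm]
  refine Finset.sum_congr rfl fun j _ => ?_
  rw [← Finset.sum_filter, Finset.sum_const, Nat.Ioc_filter_dvd_card_eq_div, nsmul_eq_mul, mul_comm]

lemma sum_margW_sq (r n : ℕ) : ∑ k ∈ Finset.Ioc 0 n, margW r n k ^ 2 =
    ∑ i ∈ Finset.Ioc 0 n, ∑ j ∈ Finset.Ioc 0 n,
      margWCoeff r n i * margWCoeff r n j * ((n / i.lcm j : ℕ) : ℝ) := by
  have h : ∀ k ∈ Finset.Ioc 0 n, margW r n k ^ 2 = ∑ i ∈ Finset.Ioc 0 n, ∑ j ∈ Finset.Ioc 0 n,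
      if i.lcm j ∣ k then margWCoeff r n i * margWCoeff r n j else 0 := fun k hk => by
    rw [margW_eq_sum_coeff hk, sq, Finset.sum_mul_sum]
    refine Finset.sum_congr rfl fun i _ => Finset.sum_congr rfl fun j _ => ?_
    rw [ite_zero_mul_ite_zero]
    simp only [Nat.lcm_dvd_iff]
  rw [Finset.sum_congr rfl h, Finset.sum_comm]
  refine Finset.sum_congr rfl fun i _ => ?_
  rw [Finset.sum_comm]
  refine Finset.sum_congr rfl fun j _ => ?_
  rw [← Finset.sum_filter, Finset.sum_const, Nat.Ioc_filter_dvd_card_eq_div, nsmul_eq_mul, mul_comm]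

lemma margWVar_eq_tsum {r : ℕ} (hr : r ≠ 0) (n : ℕ) : margWVar r n =
    ∑' p : ℕ × ℕ, margWCoeff r n p.1 * margWCoeff r n p.2 *
      (((n / p.1.lcm p.2 : ℕ) : ℝ) / n -
        ((n / p.1 : ℕ) : ℝ) / n * (((n / p.2 : ℕ) : ℝ) / n)) := by
  rw [tsum_eq_sum (s := Finset.Ioc 0 n ×ˢ Finset.Ioc 0 n)]
  · rw [margWVar, show Finset.Icc 1 n = Finset.Ioc 0 n from rfl, sum_margW, sum_margW_sq,
      Finset.sum_product, mul_pow, sq (∑ j ∈ Finset.Ioc 0 n, _), Finset.sum_mul_sum,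
      Finset.mul_sum, Finset.mul_sum, ← Finset.sum_sub_distrib]
    refine Finset.sum_congr rfl fun i _ => ?_
    rw [Finset.mul_sum, Finset.mul_sum, ← Finset.sum_sub_distrib]
    refine Finset.sum_congr rfl fun j _ => ?_
    ring
  · rintro ⟨i, j⟩ hij
    rw [Finset.mem_product, not_and_or] at hij
    rcases hij with h | h <;> simp [margWCoeff_eq_zero hr h]

lemma natCast_div_div_le (n i : ℕ) : ((n / i : ℕ) : ℝ) / n ≤ 1 / i := by
  rcases Nat.eq_zero_or_pos n with rfl | hn
  · simp
  · have hn0 : (0 : ℝ) < n := by exact_mod_cast hn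
    calc ((n / i : ℕ) : ℝ) / n ≤ (n : ℝ) / i / n := by
          gcongr
          exact Nat.cast_div_le
      _ = 1 / i := by field_simp

lemma tendsto_natCast_div_div (i : ℕ) :
    Tendsto (fun n : ℕ => ((n / i : ℕ) : ℝ) / n) atTop (nhds (1 / i)) := by
  have h := (tendsto_nat_floor_mul_div_atTop (R := ℝ) (a := 1 / i) (by positivity)).comp
    tendsto_natCast_atTop_atTop
  refine h.congr fun n => ?_
  simp only [Function.comp_apply]
  rw [one_div_mul_eq_div, Nat.floor_div_eq_div]

lemma one_div_lcm_sub (i j : ℕ) (hi : i ≠ 0) (hj : j ≠ 0) :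
    1 / (i.lcm j : ℝ) - 1 / (i : ℝ) * (1 / j) = ((i.gcd j : ℝ) - 1) / (i * j) := by
  have hl : (i.lcm j : ℝ) ≠ 0 := by exact_mod_cast Nat.lcm_ne_zero hi hj
  have hi0 : (i : ℝ) ≠ 0 := by exact_mod_cast hi
  have hj0 : (j : ℝ) ≠ 0 := by exact_mod_cast hj
  have hg : (i.gcd j : ℝ) * i.lcm j = i * j := by exact_mod_cast Nat.gcd_mul_lcm i j
  field_simp
  linarith

lemma gcd_le_rpow_mul_rpow {i j : ℕ} (hi : 0 < i) (hj : 0 < j) :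
    (i.gcd j : ℝ) ≤ (i : ℝ) ^ (1 / 2 : ℝ) * (j : ℝ) ^ (1 / 2 : ℝ) := by
  have h1 : (i.gcd j : ℝ) ≤ i := by exact_mod_cast Nat.gcd_le_left j hi
  have h2 : (i.gcd j : ℝ) ≤ j := by exact_mod_cast Nat.gcd_le_right i hj
  rw [← Real.sqrt_eq_rpow, ← Real.sqrt_eq_rpow, ← Real.sqrt_mul (Nat.cast_nonneg i)]
  refine Real.le_sqrt_of_sq_le ?_
  rw [sq]
  gcongr

lemma margWCoeff_le {r : ℕ} (hr : 2 ≤ r) (n : ℕ) {i : ℕ} (hi : 0 < i) :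
    margWCoeff r n i ≤ 1 / (i : ℝ) := by
  have hi1 : (1 : ℝ) ≤ i := by exact_mod_cast hi
  calc margWCoeff r n i ≤ (i : ℝ) * (1 / i) ^ r := by
        unfold margWCoeff
        have h := natCast_div_div_le n i
        have h2 : (Nat.totient i : ℝ) ≤ i := by exact_mod_cast Nat.totient_le i
        exact mul_le_mul h2 (pow_le_pow_left₀ (by positivity) h r) (by positivity) (by positivity)
    _ ≤ (i : ℝ) * (1 / i) ^ 2 := by
        gcongr ?_ * ?_
        exact pow_le_pow_of_le_one (by positivity) (div_le_one_of_le₀ hi1 (by positivity)) hr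
    _ = 1 / i := by field_simp

lemma norm_margWVar_term_le {r : ℕ} (hr : 2 ≤ r) (n i j : ℕ) :
    ‖margWCoeff r n i * margWCoeff r n j * (((n / i.lcm j : ℕ) : ℝ) / n -
        ((n / i : ℕ) : ℝ) / n * (((n / j : ℕ) : ℝ) / n))‖ ≤
      1 / (i : ℝ) ^ (3 / 2 : ℝ) * (1 / (j : ℝ) ^ (3 / 2 : ℝ)) := by
  rcases Nat.eq_zero_or_pos i with rfl | hi
  · rw [margWCoeff_eq_zero (by lia) (by simp), zero_mul, zero_mul, norm_zero]
    positivity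
  rcases Nat.eq_zero_or_pos j with rfl | hj
  · rw [margWCoeff_eq_zero (j := 0) (by lia) (by simp), mul_zero, zero_mul, norm_zero]
    positivity
  have hi0 : (0 : ℝ) < i := by exact_mod_cast hi
  have hj0 : (0 : ℝ) < j := by exact_mod_cast hj
  have hl0 : (0 : ℝ) < i.lcm j := by exact_mod_cast Nat.lcm_pos hi hj
  have hg1 : (1 : ℝ) ≤ i.gcd j := by exact_mod_cast Nat.gcd_pos_of_pos_left j hi
  have hgl : (i.gcd j : ℝ) * i.lcm j = i * j := by exact_mod_cast Nat.gcd_mul_lcm i j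
  have e1 : 1 / (i.lcm j : ℝ) = i.gcd j / (i * j) := by
    rw [← hgl]
    field_simp
  have b1 : ((n / i.lcm j : ℕ) : ℝ) / n ≤ i.gcd j / (i * j) :=
    (natCast_div_div_le n _).trans_eq e1
  have b2 : ((n / i : ℕ) : ℝ) / n * (((n / j : ℕ) : ℝ) / n) ≤ i.gcd j / (i * j) := by
    calc ((n / i : ℕ) : ℝ) / n * (((n / j : ℕ) : ℝ) / n) ≤ 1 / i * (1 / j) := by
          exact mul_le_mul (natCast_div_div_le n _) (natCast_div_div_le n _) (by positivity)
            (by positivity)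
      _ = 1 / (i * j) := by rw [one_div_mul_one_div]
      _ ≤ _ := by gcongr
  have c1 : 0 ≤ ((n / i.lcm j : ℕ) : ℝ) / n := by positivity
  have c2 : 0 ≤ ((n / i : ℕ) : ℝ) / n * (((n / j : ℕ) : ℝ) / n) := by positivity
  have b3 : |((n / i.lcm j : ℕ) : ℝ) / n - ((n / i : ℕ) : ℝ) / n * (((n / j : ℕ) : ℝ) / n)| ≤
      i.gcd j / (i * j) := by
    rw [abs_le]
    constructor <;> linarith
  have hpow : ∀ x : ℝ, 0 < x → 1 / x * (1 / x) * x ^ (1 / 2 : ℝ) = 1 / x ^ (3 / 2 : ℝ) :=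
    fun x hx => by
      rw [one_div_mul_one_div, ← sq, ← Real.rpow_natCast x 2, one_div,
        one_div (x ^ (3 / 2 : ℝ)), ← Real.rpow_neg hx.le, ← Real.rpow_neg hx.le, ← Real.rpow_add hx]
      norm_num
  rw [Real.norm_eq_abs, abs_mul, abs_mul, abs_of_nonneg (margWCoeff_nonneg r n i),
    abs_of_nonneg (margWCoeff_nonneg r n j)]
  calc margWCoeff r n i * margWCoeff r n j * _
      ≤ 1 / i * (1 / j) * (i.gcd j / (i * j)) := by
        gcongr
        · exact margWCoeff_nonneg r n j
        · exact margWCoeff_le hr n hi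
        · exact margWCoeff_le hr n hj
    _ ≤ 1 / i * (1 / j) * (((i : ℝ) ^ (1 / 2 : ℝ) * (j : ℝ) ^ (1 / 2 : ℝ)) / (i * j)) := by
        gcongr
        exact gcd_le_rpow_mul_rpow hi hj
    _ = (1 / i * (1 / i) * (i : ℝ) ^ (1 / 2 : ℝ)) * (1 / j * (1 / j) * (j : ℝ) ^ (1 / 2 : ℝ)) := by
        ring
    _ = _ := by rw [hpow _ hi0, hpow _ hj0]

lemma tendsto_margWVar {r : ℕ} (hr : 2 ≤ r) :
    Tendsto (fun n : ℕ => margWVar r n) atTop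
      (nhds (∑' p : ℕ+ × ℕ+,
        (Nat.totient p.1 : ℝ) / (p.1 : ℝ) ^ (r + 1) *
          ((Nat.totient p.2 : ℝ) / (p.2 : ℝ) ^ (r + 1)) * ((Nat.gcd p.1 p.2 : ℝ) - 1))) := by
  have hinj : Function.Injective (Prod.map PNat.val PNat.val : ℕ+ × ℕ+ → ℕ × ℕ) :=
    PNat.coe_injective.prodMap PNat.coe_injective
  have hlim := hinj.tsum_eq (f := fun p : ℕ × ℕ =>
    (Nat.totient p.1 : ℝ) / (p.1 : ℝ) ^ (r + 1) *
      ((Nat.totient p.2 : ℝ) / (p.2 : ℝ) ^ (r + 1)) * ((Nat.gcd p.1 p.2 : ℝ) - 1)) (by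
    rintro ⟨i, j⟩ hij
    rcases Nat.eq_zero_or_pos i with rfl | hi
    · simp at hij
    rcases Nat.eq_zero_or_pos j with rfl | hj
    · simp at hij
    exact ⟨(⟨i, hi⟩, ⟨j, hj⟩), rfl⟩)
  simp only [Prod.map_fst, Prod.map_snd] at hlim
  refine Eq.subst (motive := fun s => Tendsto _ atTop (nhds s)) hlim.symm ?_
  simp only [margWVar_eq_tsum (by lia : r ≠ 0)]
  have hs : Summable fun n : ℕ => 1 / (n : ℝ) ^ (3 / 2 : ℝ) :=
    Real.summable_one_div_nat_rpow.2 (by norm_num)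
  refine tendsto_tsum_of_dominated_convergence
    (hs.mul_of_nonneg hs (fun n => by positivity) fun n => by positivity) (fun p => ?_)
    (Eventually.of_forall fun n p => norm_margWVar_term_le hr n p.1 p.2)
  obtain ⟨i, j⟩ := p
  have hc : ∀ i : ℕ, Tendsto (fun n => margWCoeff r n i) atTop
      (nhds ((Nat.totient i : ℝ) * (1 / i) ^ r)) := fun i =>
    ((tendsto_natCast_div_div i).pow r).const_mul _
  have h := ((hc i).mul (hc j)).mul ((tendsto_natCast_div_div (i.lcm j)).sub
    ((tendsto_natCast_div_div i).mul (tendsto_natCast_div_div j)))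
  convert h using 2
  rcases eq_or_ne i 0 with rfl | hi
  · simp
  rcases eq_or_ne j 0 with rfl | hj
  · simp
  rw [one_div_lcm_sub i j hi hj]
  have hi0 : (i : ℝ) ≠ 0 := by exact_mod_cast hi
  have hj0 : (j : ℝ) ≠ 0 := by exact_mod_cast hj
  simp only [one_div, inv_pow]
  field_simp
  ring

lemma sum_pillaiRatio_sq (n : ℕ) : ∑ k ∈ Finset.Ioc 0 n, pillaiRatio k ^ 2 =
    ∑' d : ℕ, pillaiSqQuotient d * sumZetaPow 4 ((n : ℝ) / d) := by
  have h := ArithmeticFunction.sum_Ioc_mul_eq_sum_sum pillaiSqQuotient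
    ((ArithmeticFunction.zeta : ArithmeticFunction ℝ) ^ 4) n
  rw [pillaiSqQuotient_mul_zeta_pow] at h
  simp only [ArithmeticFunction.pmul_apply, ← sq] at h
  rw [h, tsum_eq_sum (s := Finset.Ioc 0 n)]
  · refine Finset.sum_congr rfl fun d _ => ?_
    rw [sumZetaPow, Nat.floor_div_eq_div]
  · intro d hd
    rcases Nat.eq_zero_or_pos d with rfl | hd0
    · simp
    · have hlt : n < d := by
        by_contra hcon
        exact hd (Finset.mem_Ioc.2 ⟨hd0, not_lt.1 hcon⟩)
      rw [sumZetaPow_of_lt_one, mul_zero]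
      rw [div_lt_one (by exact_mod_cast hd0)]
      exact_mod_cast hlt

lemma tendsto_log_natCast_atTop : Tendsto (fun n : ℕ => Real.log n) atTop atTop :=
  Real.tendsto_log_atTop.comp tendsto_natCast_atTop_atTop

lemma tendsto_log_div_div_log {d : ℕ} (hd : d ≠ 0) :
    Tendsto (fun n : ℕ => Real.log ((n : ℝ) / d) / Real.log n) atTop (nhds 1) := by
  have h : Tendsto (fun n : ℕ => 1 - Real.log d / Real.log n) atTop (nhds (1 - 0)) :=
    tendsto_const_nhds.sub (tendsto_const_nhds.div_atTop tendsto_log_natCast_atTop)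
  rw [sub_zero] at h
  refine h.congr' ?_
  filter_upwards [eventually_ge_atTop 2] with n hn
  have hn1 : (1 : ℝ) < n := by exact_mod_cast hn
  have hL := Real.log_pos hn1
  rw [Real.log_div (by positivity) (by exact_mod_cast hd)]
  field_simp

lemma tendsto_sumZetaPow_four_div {d : ℕ} (hd : d ≠ 0) :
    Tendsto (fun n : ℕ => sumZetaPow 4 ((n : ℝ) / d) / ((n : ℝ) / d * Real.log n ^ 3)) atTop
      (nhds (1 / 6)) := by
  have hd0 : (0 : ℝ) < d := by exact_mod_cast Nat.pos_of_ne_zero hd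
  have hinv : Tendsto (fun n : ℕ => (Real.log n)⁻¹) atTop (nhds 0) :=
    tendsto_inv_atTop_zero.comp tendsto_log_natCast_atTop
  have hl := tendsto_log_div_div_log hd
  have hmain : Tendsto (fun n : ℕ => 1 / 6 * (Real.log ((n : ℝ) / d) / Real.log n) ^ 3) atTop
      (nhds (1 / 6)) := by
    have h := (hl.pow 3).const_mul (1 / 6)
    rwa [one_pow, mul_one] at h
  have herr : Tendsto (fun n : ℕ => 7 / 2 * ((Real.log n)⁻¹ + Real.log ((n : ℝ) / d) / Real.log n) ^ 2
      * (Real.log n)⁻¹) atTop (nhds 0) := by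
    simpa using (((hinv.add hl).pow 2).const_mul (7 / 2)).mul hinv
  refine (hmain.congr_dist (squeeze_zero' (Eventually.of_forall fun _ => dist_nonneg) ?_ herr))
  filter_upwards [eventually_ge_atTop (d + 1)] with n hn
  have hnd : (d : ℝ) + 1 ≤ n := by exact_mod_cast hn
  have hd1 : (1 : ℝ) ≤ d := by exact_mod_cast Nat.pos_of_ne_zero hd
  have hL : 0 < Real.log n := Real.log_pos (by linarith)
  have hy : 1 ≤ (n : ℝ) / d := (one_le_div hd0).2 (by linarith)
  have h4 := abs_sumZetaPow_four_sub_le hy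
  set y := (n : ℝ) / d
  have hy0 : 0 < y := by linarith
  rw [dist_comm, Real.dist_eq]
  have e : sumZetaPow 4 y / (y * Real.log n ^ 3) - 1 / 6 * (Real.log y / Real.log n) ^ 3 =
      (sumZetaPow 4 y - 1 / 6 * y * Real.log y ^ 3) / (y * Real.log n ^ 3) := by
    field_simp
  rw [e, abs_div, abs_of_pos (by positivity : 0 < y * Real.log n ^ 3), div_le_iff₀ (by positivity)]
  refine h4.trans (le_of_eq ?_)
  field_simp

lemma abs_sumZetaPow_four_div_le {n d : ℕ} (hn : 1 ≤ Real.log n) :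
    |sumZetaPow 4 ((n : ℝ) / d) / ((n : ℝ) / d * Real.log n ^ 3)| ≤ 32 := by
  set y := (n : ℝ) / d
  rcases lt_or_ge y 1 with hy | hy
  · rw [sumZetaPow_of_lt_one 4 hy]
    norm_num
  · have hy0 : 0 < y := by linarith
    have hd1 : (1 : ℝ) ≤ d := by
      rcases Nat.eq_zero_or_pos d with hd | hd
      · simp only [y, hd, Nat.cast_zero, div_zero] at hy
        linarith
      · exact_mod_cast hd
    have hl : Real.log y ≤ Real.log n :=
      Real.log_le_log hy0 (div_le_self (Nat.cast_nonneg n) hd1)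
    have hl0 := Real.log_nonneg hy
    have h4 := abs_sumZetaPow_four_sub_le hy
    rw [abs_div, abs_of_pos (by positivity : 0 < y * Real.log n ^ 3), div_le_iff₀ (by positivity)]
    have h5 : 7 / 2 * y * (1 + Real.log y) ^ 2 ≤ 7 / 2 * y * (4 * Real.log n ^ 3) := by
      gcongr
      calc (1 + Real.log y) ^ 2 ≤ (Real.log n + Real.log n) ^ 2 := by gcongr
        _ = 4 * (Real.log n ^ 2 * 1) := by ring
        _ ≤ 4 * (Real.log n ^ 2 * Real.log n) := by gcongr
        _ = _ := by ring
    have h6 : |1 / 6 * y * Real.log y ^ 3| ≤ 1 / 6 * y * Real.log n ^ 3 := by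
      rw [abs_of_nonneg (by positivity)]
      gcongr
    have h7 := abs_sub_abs_le_abs_sub (sumZetaPow 4 y) (1 / 6 * y * Real.log y ^ 3)
    have h8 : 0 ≤ y * Real.log n ^ 3 := by positivity
    linarith

lemma tendsto_sum_pillaiRatio_sq_div :
    Tendsto (fun n : ℕ => (∑ k ∈ Finset.Ioc 0 n, pillaiRatio k ^ 2) / (n * Real.log n ^ 3)) atTop
      (nhds DeltaToth) := by
  have hD : DeltaToth = ∑' d : ℕ, pillaiSqWeight d * (1 / 6) := by
    rw [DeltaToth, tsum_mul_right, tsum_pillaiSqWeight, mul_comm]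
  have key : Tendsto (fun n : ℕ => ∑' d : ℕ, pillaiSqWeight d *
      (sumZetaPow 4 ((n : ℝ) / d) / ((n : ℝ) / d * Real.log n ^ 3))) atTop
      (nhds (∑' d : ℕ, pillaiSqWeight d * (1 / 6))) := by
    refine tendsto_tsum_of_dominated_convergence (summable_abs_pillaiSqWeight.mul_right 32)
      (fun d => ?_) ?_
    · rcases eq_or_ne d 0 with rfl | hd
      · simp [pillaiSqWeight]
      · exact (tendsto_sumZetaPow_four_div hd).const_mul _
    · filter_upwards [tendsto_log_natCast_atTop.eventually_ge_atTop 1] with n hn d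
      rw [Real.norm_eq_abs, abs_mul]
      gcongr
      exact abs_sumZetaPow_four_div_le hn
  rw [hD]
  refine key.congr fun n => ?_
  rw [sum_pillaiRatio_sq, ← tsum_div_const]
  refine tsum_congr fun d => ?_
  rcases eq_or_ne d 0 with rfl | hd
  · simp [pillaiSqWeight]
  · have hd0 : (d : ℝ) ≠ 0 := by exact_mod_cast hd
    rw [pillaiSqWeight]
    field_simp

lemma sum_pillaiRatio_le {n : ℕ} (hn : 1 ≤ n) :
    ∑ k ∈ Finset.Ioc 0 n, pillaiRatio k ≤ n * (Real.log n + 2) := by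
  have hn1 : (1 : ℝ) ≤ n := by exact_mod_cast hn
  have h1 : ∑ k ∈ Finset.Ioc 0 n, pillaiRatio k ≤ sumZetaPow 2 n := by
    rw [sumZetaPow, Nat.floor_natCast]
    refine Finset.sum_le_sum fun k _ => ?_
    rw [pillaiRatio_apply, sq, ArithmeticFunction.coe_zeta_mul_apply]
    refine Finset.sum_le_sum fun j hj => ?_
    have hj0 : j ≠ 0 := (Nat.pos_of_mem_divisors hj).ne'
    rw [ArithmeticFunction.natCoe_apply, ArithmeticFunction.zeta_apply_ne hj0, Nat.cast_one]
    exact div_le_one_of_le₀ (by exact_mod_cast Nat.totient_le j) (Nat.cast_nonneg j)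
  have h2 := (abs_le.1 (abs_sumZetaPow_two_sub_le hn1)).2
  linarith

lemma margW_one_bounds {n k : ℕ} (hk : k ∈ Finset.Ioc 0 n) :
    0 ≤ margW 1 n k ∧ margW 1 n k ≤ pillaiRatio k ∧ pillaiRatio k ≤ margW 1 n k + 1 := by
  rw [Finset.mem_Ioc] at hk
  have hn0 : (0 : ℝ) < n := by exact_mod_cast hk.1.trans_le hk.2
  have e : margW 1 n k =
      ∑ j ∈ k.divisors, (Nat.totient j : ℝ) * (((n / j : ℕ) : ℝ) / n) := by
    rw [margW, Finset.mul_sum]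
    exact Finset.sum_congr rfl fun j _ => by simp; ring
  have hfl : ∀ j : ℕ, j ∈ k.divisors → ((n / j : ℕ) : ℝ) / n ≤ 1 / j ∧
      1 / (j : ℝ) ≤ ((n / j : ℕ) : ℝ) / n + 1 / n := fun j hj => by
    have hj0 : (0 : ℝ) < j := by exact_mod_cast Nat.pos_of_mem_divisors hj
    have h1 : ((n / j : ℕ) : ℝ) ≤ n / j := Nat.cast_div_le
    have h2 : (n : ℝ) / j < ((n / j : ℕ) : ℝ) + 1 := by
      have := Nat.lt_floor_add_one ((n : ℝ) / j)
      rwa [Nat.floor_div_eq_div] at this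
    rw [← add_div, div_le_div_iff₀ hn0 hj0, div_le_div_iff₀ hj0 hn0]
    rw [le_div_iff₀ hj0] at h1
    rw [div_lt_iff₀ hj0] at h2
    constructor <;> linarith
  refine ⟨by rw [e]; positivity, ?_, ?_⟩
  · rw [e, pillaiRatio_apply]
    refine Finset.sum_le_sum fun j hj => ?_
    rw [div_eq_mul_one_div (Nat.totient j : ℝ)]
    exact mul_le_mul_of_nonneg_left (hfl j hj).1 (Nat.cast_nonneg _)
  · have h1 : pillaiRatio k ≤ margW 1 n k + ∑ j ∈ k.divisors, (Nat.totient j : ℝ) * (1 / n) := by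
      rw [e, pillaiRatio_apply, ← Finset.sum_add_distrib]
      refine Finset.sum_le_sum fun j hj => ?_
      rw [div_eq_mul_one_div (Nat.totient j : ℝ), ← mul_add]
      gcongr
      exact (hfl j hj).2
    have h2 : ∑ j ∈ k.divisors, (Nat.totient j : ℝ) * (1 / n) ≤ 1 := by
      rw [← Finset.sum_mul, ← Nat.cast_sum, Nat.sum_totient, mul_one_div, div_le_one hn0]
      exact_mod_cast hk.2
    linarith

lemma abs_margWVar_one_sub_le {n : ℕ} (hn : 1 ≤ n) :
    |margWVar 1 n - (∑ k ∈ Finset.Ioc 0 n, pillaiRatio k ^ 2) / n| ≤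
      2 * (Real.log n + 2) + (Real.log n + 2) ^ 2 := by
  have hn0 : (0 : ℝ) < n := by exact_mod_cast hn
  have hL : 0 ≤ Real.log n := Real.log_natCast_nonneg n
  rw [margWVar, show Finset.Icc 1 n = Finset.Ioc 0 n from rfl]
  have hF : (1 / (n : ℝ)) * ∑ k ∈ Finset.Ioc 0 n, pillaiRatio k ≤ Real.log n + 2 := by
    rw [one_div_mul_eq_div, div_le_iff₀ hn0, mul_comm]
    exact sum_pillaiRatio_le hn
  have hW0 : 0 ≤ (1 / (n : ℝ)) * ∑ k ∈ Finset.Ioc 0 n, margW 1 n k :=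
    mul_nonneg (by positivity) (Finset.sum_nonneg fun k hk => (margW_one_bounds hk).1)
  have hW1 : (1 / (n : ℝ)) * ∑ k ∈ Finset.Ioc 0 n, margW 1 n k ≤ Real.log n + 2 := by
    refine le_trans ?_ hF
    gcongr with k hk
    exact (margW_one_bounds hk).2.1
  have hsq := pow_le_pow_left₀ hW0 hW1 2
  have hsq0 := sq_nonneg ((1 / (n : ℝ)) * ∑ k ∈ Finset.Ioc 0 n, margW 1 n k)
  have hd0 : (1 / (n : ℝ)) * ∑ k ∈ Finset.Ioc 0 n, margW 1 n k ^ 2 ≤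
      (1 / (n : ℝ)) * ∑ k ∈ Finset.Ioc 0 n, pillaiRatio k ^ 2 := by
    gcongr with k hk
    · exact (margW_one_bounds hk).1
    · exact (margW_one_bounds hk).2.1
  have hd1 : (1 / (n : ℝ)) * ∑ k ∈ Finset.Ioc 0 n, pillaiRatio k ^ 2 ≤
      (1 / (n : ℝ)) * ∑ k ∈ Finset.Ioc 0 n, margW 1 n k ^ 2 +
        2 * ((1 / (n : ℝ)) * ∑ k ∈ Finset.Ioc 0 n, pillaiRatio k) := by
    rw [mul_left_comm, ← mul_add, Finset.mul_sum _ _ (2 : ℝ), ← Finset.sum_add_distrib]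
    gcongr with k hk
    obtain ⟨w0, w1, w2⟩ := margW_one_bounds hk
    nlinarith
  rw [← one_div_mul_eq_div (n : ℝ) (∑ k ∈ Finset.Ioc 0 n, pillaiRatio k ^ 2), abs_le]
  constructor <;> linarith

lemma DeltaToth_ne_zero : DeltaToth ≠ 0 :=
  mul_ne_zero (by norm_num) tprod_toth_ne_zero

lemma tendsto_margWVar_one_div :
    Tendsto (fun n : ℕ => margWVar 1 n / (DeltaToth * Real.log n ^ 3)) atTop (nhds 1) := by
  have hinv : Tendsto (fun n : ℕ => (Real.log n)⁻¹) atTop (nhds 0) :=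
    tendsto_inv_atTop_zero.comp tendsto_log_natCast_atTop
  have hmain : Tendsto (fun n : ℕ => margWVar 1 n / Real.log n ^ 3) atTop (nhds DeltaToth) := by
    have herr : Tendsto (fun n : ℕ => 2 * (1 + 2 * (Real.log n)⁻¹) * (Real.log n)⁻¹ ^ 2 +
        (1 + 2 * (Real.log n)⁻¹) ^ 2 * (Real.log n)⁻¹) atTop (nhds 0) := by
      have h1 : Tendsto (fun n : ℕ => 1 + 2 * (Real.log n)⁻¹) atTop (nhds (1 + 2 * 0)) :=
        tendsto_const_nhds.add (hinv.const_mul 2)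
      simpa using ((h1.const_mul 2).mul (hinv.pow 2)).add ((h1.pow 2).mul hinv)
    refine tendsto_sum_pillaiRatio_sq_div.congr_dist
      (squeeze_zero' (Eventually.of_forall fun _ => dist_nonneg) ?_ herr)
    filter_upwards [eventually_ge_atTop 2] with n hn
    have hL : 0 < Real.log n := Real.log_pos (by exact_mod_cast hn)
    have hb := abs_margWVar_one_sub_le (one_le_two.trans hn)
    rw [dist_comm, Real.dist_eq, ← div_div, ← sub_div, abs_div,
      abs_of_pos (by positivity : 0 < Real.log n ^ 3), div_le_iff₀ (by positivity)]
    refine hb.trans (le_of_eq ?_)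
    field_simp
  have h := hmain.div_const DeltaToth
  rw [div_self DeltaToth_ne_zero] at h
  refine h.congr fun n => ?_
  rw [div_div, mul_comm]

/-- (a) For each fixed `r ≥ 2`, the variance `d_r^{(n)}` converges, as `n → ∞`, to
`Σ_{i,j≥1} (φ(i)/i^{r+1})(φ(j)/j^{r+1})(gcd(i,j) − 1)`; (b) for `r = 1`,
`d_1^{(n)} ∼ Δ_Toth (ln n)³` as `n → ∞`. -/
theorem margW_variance_asymptotics :
    (∀ r : ℕ, 2 ≤ r →
      Tendsto (fun n : ℕ => margWVar r n) atTop
        (nhds (∑' p : ℕ+ × ℕ+,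
          (Nat.totient p.1 : ℝ) / (p.1 : ℝ) ^ (r + 1) *
            ((Nat.totient p.2 : ℝ) / (p.2 : ℝ) ^ (r + 1)) * ((Nat.gcd p.1 p.2 : ℝ) - 1)))) ∧
    Tendsto (fun n : ℕ => margWVar 1 n / (DeltaToth * Real.log n ^ 3)) atTop (nhds 1) := by
  exact ⟨fun _ hr => tendsto_margWVar hr, tendsto_margWVar_one_div⟩
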